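/- Positive trace-preserving maps are contractive in trace norm on Hermitian matrices. Let E : M_d(ℂ) → M_D(ℂ) be a linear map that is positive (it maps every positive semidefinite matrix to a positive semidefinite matrix) and trace-preserving (Tr E(A) = Tr A for all A). Then for every Hermitian matrix A ∈ M_d(ℂ): Tr|E(A)| ≤ Tr|A|, i.e. ‖E(A)‖₁ ≤ ‖A‖₁. -/

import Mathlib

open Matrix
open scoped ComplexOrder MatrixOrder

/-- The trace norm `Tr |A|` of a square complex matrix, where `|A|` is the positive
semidefinite square root of `Aᴴ * A`. -/
noncomputable def traceNorm {n : ℕ} (A : Matrix (Fin n) (Fin n) ℂ) : ℝ :=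
  (CFC.sqrt (Aᴴ * A)).trace.re

/-- The trace of a product of two positive semidefinite matrices is nonnegative. -/
lemma trace_mul_re_nonneg {n : ℕ} {A B : Matrix (Fin n) (Fin n) ℂ}
    (hA : A.PosSemidef) (hB : B.PosSemidef) : 0 ≤ (A * B).trace.re := by
  obtain ⟨C, rfl⟩ := CStarAlgebra.nonneg_iff_eq_star_mul_self.mp hA.nonneg
  rw [Matrix.mul_assoc, Matrix.trace_mul_comm, star_eq_conjTranspose]
  exact (Complex.le_def.mp (hB.mul_mul_conjTranspose_same C).trace_nonneg).1

lemma traceNorm_eq_re_trace_abs {n : ℕ} (A : Matrix (Fin n) (Fin n) ℂ) :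
    traceNorm A = (CFC.abs A).trace.re := rfl

/-- The absolute value of a Hermitian matrix is its product with a Hermitian
contraction, its sign. -/
lemma exists_abs_eq_mul {n : ℕ} {X : Matrix (Fin n) (Fin n) ℂ} (hX : X.IsHermitian) :
    ∃ U : Matrix (Fin n) (Fin n) ℂ,
      (1 - U).PosSemidef ∧ (1 + U).PosSemidef ∧ CFC.abs X = U * X := by
  have hX' : IsSelfAdjoint X := hX
  have hcont (f : ℝ → ℝ) : ContinuousOn f (spectrum ℝ X) :=
    (Matrix.finite_real_spectrum (A := X)).continuousOn f
  let s : ℝ → ℝ := fun x => if 0 ≤ x then 1 else -1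
  have hs (x : ℝ) : -1 ≤ s x ∧ s x ≤ 1 := by
    simp only [s]; split_ifs <;> norm_num
  have hle : cfc s X ≤ 1 := cfc_le_one s X fun x _ => (hs x).2
  have hge : -1 ≤ cfc s X := by
    have h := cfc_mono (a := X) (f := fun _ => (-1 : ℝ)) (g := s) (fun x _ => (hs x).1)
      (hcont _) (hcont _)
    rwa [cfc_const (-1 : ℝ) X, map_neg, map_one] at h
  refine ⟨cfc s X, Matrix.le_iff.mp hle, ?_, ?_⟩
  · simpa [add_comm] using Matrix.le_iff.mp hge
  · rw [CFC.abs_eq_cfc_norm X]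
    nth_rw 3 [← cfc_id' ℝ X]
    rw [← cfc_mul s (fun x => x) X (hcont _) (hcont _)]
    refine cfc_congr fun x _ => ?_
    simp only [s, Real.norm_eq_abs]
    split_ifs with h
    · rw [abs_of_nonneg h, one_mul]
    · rw [abs_of_neg (not_le.mp h), neg_one_mul]

/-- The trace norm of a difference of positive semidefinite matrices is at most the sum
of their traces. -/
lemma traceNorm_sub_le {n : ℕ} {R S : Matrix (Fin n) (Fin n) ℂ}
    (hR : R.PosSemidef) (hS : S.PosSemidef) :
    traceNorm (R - S) ≤ (R + S).trace.re := by
  obtain ⟨U, hU₁, hU₂, hU⟩ := exists_abs_eq_mul (hR.isHermitian.sub hS.isHermitian)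
  have h₁ := trace_mul_re_nonneg hU₁ hR
  have h₂ := trace_mul_re_nonneg hU₂ hS
  rw [traceNorm_eq_re_trace_abs, hU]
  simp only [sub_mul, add_mul, mul_sub, one_mul, trace_sub, trace_add, Complex.sub_re,
    Complex.add_re] at *
  linarith

/-- **Positive trace-preserving maps are contractive in trace norm on Hermitian
matrices.** If a linear map `E : M_d(ℂ) → M_D(ℂ)` maps positive semidefinite matrices
to positive semidefinite matrices and preserves the trace, then `Tr|E(A)| ≤ Tr|A|` for
every Hermitian `A`. -/
theorem positive_trace_preserving_contractive
    (d D : ℕ) (E : Matrix (Fin d) (Fin d) ℂ →ₗ[ℂ] Matrix (Fin D) (Fin D) ℂ)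
    (hpos : ∀ A : Matrix (Fin d) (Fin d) ℂ, A.PosSemidef → (E A).PosSemidef)
    (hTP : ∀ A : Matrix (Fin d) (Fin d) ℂ, (E A).trace = A.trace)
    (A : Matrix (Fin d) (Fin d) ℂ) (hA : A.IsHermitian) :
    traceNorm (E A) ≤ traceNorm A := by
  have hA' : IsSelfAdjoint A := hA
  have hP : (A⁺).PosSemidef := Matrix.nonneg_iff_posSemidef.mp (CFC.posPart_nonneg A)
  have hN : (A⁻).PosSemidef := Matrix.nonneg_iff_posSemidef.mp (CFC.negPart_nonneg A)
  have h := traceNorm_sub_le (hpos _ hP) (hpos _ hN)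
  rwa [← map_sub, ← map_add, hTP, CFC.posPart_sub_negPart A, CFC.posPart_add_negPart A,
    ← traceNorm_eq_re_trace_abs] at h
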